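/- arXiv:2211.00950 — 2 statements merged into one kernel-verified Lean document; each statement's English description precedes it below -/
import Mathlib

section
/- Let k ∈ {1,2} and let λ = a_1 ϖ_1 + a_2 ϖ_2 where a_1, a_2 are nonnegative integers and a_k = 0. Then T_{λ,k} ∩ ℤ = {1, 2, …, M_{λ,k}} if and only if for every integer t at least one of the following holds: (1) (λ+ρ−tϖ_k, α) > 0 for every α ∈ Φ⁺; (2) the number of α ∈ Φ⁺ with (λ+ρ−tϖ_k, α) < 0 equals the cardinality of Φ⁺_k and (λ+ρ−tϖ_k, α) ≠ 0 for every α ∈ Φ⁺; (3) there exists α ∈ Φ⁺ with (λ+ρ−tϖ_k, α) = 0. -/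
noncomputable section

/-- The ambient space ℝ^3. -/
abbrev V : Type := Fin 3 → ℝ

/-- The standard inner product on ℝ^3. -/
def ip (x y : V) : ℝ := ∑ i, x i * y i

/-- The standard basis vectors ε_1, ε_2, ε_3 (indexed from 0). -/
def eps (i : Fin 3) : V := fun j => if j = i then 1 else 0

/-- The G2 root system: ±(ε_i−ε_j) (i<j) and ±(2ε_i−ε_j−ε_k)
    with {i,j,k} = {1,2,3}. -/
def PhiG2 : Set V :=
  {α | (∃ i j : Fin 3, i < j ∧ (α = eps i - eps j ∨ α = eps j - eps i)) ∨
       (∃ i j k : Fin 3, i ≠ j ∧ i ≠ k ∧ j ≠ k ∧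
          (α = (2 : ℝ) • eps i - eps j - eps k ∨
           α = -((2 : ℝ) • eps i - eps j - eps k)))}

/-- Simple roots α_1, α_2 of G2 (indexed from 0). -/
def sroot : Fin 2 → V :=
  ![eps 1 - eps 2,
    eps 0 - (2 : ℝ) • eps 1 + eps 2]

/-- Positive roots of G2: elements of Φ_{G2} that are nonnegative
    combinations of the simple roots. -/
def PosG : Set V :=
  {α | α ∈ PhiG2 ∧ ∃ c : Fin 2 → ℝ, (∀ i, 0 ≤ c i) ∧ α = ∑ i, c i • sroot i}

/-- Fundamental weights ϖ_1, ϖ_2 of G2 (indexed from 0). -/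
def wG : Fin 2 → V :=
  ![eps 0 - eps 2,
    (2 : ℝ) • eps 0 - eps 1 - eps 2]

/-- ρ = ϖ_1 + ϖ_2. -/
def rhoG : V := ∑ i, wG i

/-- Φ⁺_k = {α ∈ Φ⁺ : (ϖ_k, α) ≠ 0}. -/
def PhiKG (k : Fin 2) : Set V := {α ∈ PosG | ip (wG k) α ≠ 0}

/-- λ = a_1 ϖ_1 + a_2 ϖ_2. -/
def lamG (a : Fin 2 → ℕ) : V := ∑ i, (a i : ℝ) • wG i

/-- T_{λ,k} = {(λ+ρ, α)/c_{α,k} : α ∈ Φ⁺_k}. -/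
def TG (a : Fin 2 → ℕ) (k : Fin 2) : Set ℝ :=
  {r | ∃ α ∈ PhiKG k, r = ip (lamG a + rhoG) α / ip (wG k) α}

/-- M_{λ,k} = max T_{λ,k} (the set is finite and nonempty, so max = sSup). -/
def MG (a : Fin 2 → ℕ) (k : Fin 2) : ℝ := sSup (TG a k)

/-- The condition T_{λ,k} ∩ ℤ = {1, 2, …, M_{λ,k}}. -/
def ACMG (a : Fin 2 → ℕ) (k : Fin 2) : Prop :=
  {n : ℤ | (n : ℝ) ∈ TG a k} = {n : ℤ | 1 ≤ n ∧ (n : ℝ) ≤ MG a k}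

lemma ip_add_left (x y z : V) : ip (x + y) z = ip x z + ip y z := by
  simp [ip, add_mul, Finset.sum_add_distrib]

lemma ip_sub_left (x y z : V) : ip (x - y) z = ip x z - ip y z := by
  simp [ip, sub_mul, Finset.sum_sub_distrib]

lemma ip_smul_left (c : ℝ) (x y : V) : ip (c • x) y = c * ip x y := by
  simp [ip, Finset.mul_sum, mul_assoc]

lemma ip_lamG_add_rhoG (a : Fin 2 → ℕ) (α : V) :
    ip (lamG a + rhoG) α = (a 0 + 1) * ip (wG 0) α + (a 1 + 1) * ip (wG 1) α := by
  simp only [lamG, rhoG, Fin.sum_univ_two, ip_add_left, ip_smul_left]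
  ring

lemma ip_wG_zero_comb (c : Fin 2 → ℝ) : ip (wG 0) (∑ i, c i • sroot i) = c 0 := by
  simp [ip, wG, sroot, eps, Fin.sum_univ_succ]

lemma ip_wG_one_comb (c : Fin 2 → ℝ) : ip (wG 1) (∑ i, c i • sroot i) = 3 * c 1 := by
  simp [ip, wG, sroot, eps, Fin.sum_univ_succ]
  ring

lemma PhiG2_finite : PhiG2.Finite := by
  refine Set.Finite.subset
    (((Set.finite_range fun p : Fin 3 × Fin 3 => eps p.1 - eps p.2).union
      (Set.finite_range fun p : Fin 3 × Fin 3 × Fin 3 =>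
        (2 : ℝ) • eps p.1 - eps p.2.1 - eps p.2.2)).union
      (Set.finite_range fun p : Fin 3 × Fin 3 × Fin 3 =>
        -((2 : ℝ) • eps p.1 - eps p.2.1 - eps p.2.2))) ?_
  rintro α (⟨i, j, -, rfl | rfl⟩ | ⟨i, j, k, -, -, -, rfl | rfl⟩)
  · exact Or.inl (Or.inl ⟨(i, j), rfl⟩)
  · exact Or.inl (Or.inl ⟨(j, i), rfl⟩)
  · exact Or.inl (Or.inr ⟨(i, j, k), rfl⟩)
  · exact Or.inr ⟨(i, j, k), rfl⟩

lemma PosG_finite : PosG.Finite := PhiG2_finite.subset fun _ h => h.1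

lemma ne_zero_of_mem_PhiG2 {α : V} (h : α ∈ PhiG2) : α ≠ 0 := by
  rintro rfl
  rcases h with ⟨i, j, hij, h | h⟩ | ⟨i, j, k, hij, hik, -, h | h⟩
  · simpa [eps, hij.ne] using congrFun h i
  · simpa [eps, hij.ne] using congrFun h i
  · simpa [eps, hij, hik] using congrFun h i
  · simpa [eps, hij, hik] using congrFun h i

lemma ip_wG_nonneg {α : V} (h : α ∈ PosG) (i : Fin 2) : 0 ≤ ip (wG i) α := by
  obtain ⟨-, c, hc, rfl⟩ := h
  fin_cases i
  · exact (ip_wG_zero_comb c).symm ▸ hc 0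
  · exact (ip_wG_one_comb c).symm ▸ mul_nonneg (by norm_num) (hc 1)

lemma ip_wG_add_pos {α : V} (h : α ∈ PosG) : 0 < ip (wG 0) α + ip (wG 1) α := by
  obtain ⟨hα, c, hc, rfl⟩ := h
  rw [ip_wG_zero_comb, ip_wG_one_comb]
  by_contra! hle
  have h0 : c 0 = 0 := by linarith [hc 0, hc 1]
  have h1 : c 1 = 0 := by linarith [hc 0, hc 1]
  exact ne_zero_of_mem_PhiG2 hα (by simp [Fin.sum_univ_two, h0, h1])

lemma ip_lamG_add_rhoG_pos (a : Fin 2 → ℕ) {α : V} (h : α ∈ PosG) :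
    0 < ip (lamG a + rhoG) α := by
  have h0 := mul_nonneg (Nat.cast_nonneg (α := ℝ) (a 0)) (ip_wG_nonneg h 0)
  have h1 := mul_nonneg (Nat.cast_nonneg (α := ℝ) (a 1)) (ip_wG_nonneg h 1)
  rw [ip_lamG_add_rhoG]
  linarith [ip_wG_add_pos h]

lemma ip_wG_le_ip_lamG_add_rhoG (a : Fin 2 → ℕ) {α : V} (h : α ∈ PosG) (k : Fin 2) :
    ip (wG k) α ≤ ip (lamG a + rhoG) α := by
  have h0 := mul_nonneg (Nat.cast_nonneg (α := ℝ) (a 0)) (ip_wG_nonneg h 0)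
  have h1 := mul_nonneg (Nat.cast_nonneg (α := ℝ) (a 1)) (ip_wG_nonneg h 1)
  rw [ip_lamG_add_rhoG]
  have h2 := ip_wG_nonneg h 0
  have h3 := ip_wG_nonneg h 1
  fin_cases k <;> simp only [Fin.zero_eta, Fin.mk_one] <;> linarith

lemma sroot_eq_comb (k : Fin 2) :
    sroot k = ∑ i, (Pi.single k (1 : ℝ) : Fin 2 → ℝ) i • sroot i := by
  simp [Pi.single_apply]

lemma sroot_mem_PosG (k : Fin 2) : sroot k ∈ PosG := by
  refine ⟨?_, Pi.single k 1, fun i => ?_, sroot_eq_comb k⟩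
  · fin_cases k
    · exact Or.inl ⟨1, 2, by decide, Or.inl rfl⟩
    · refine Or.inr ⟨1, 0, 2, by decide, by decide, by decide, Or.inr ?_⟩
      simp only [sroot, Fin.mk_one, Matrix.cons_val_one, Matrix.cons_val_fin_one]
      abel
  · rw [Pi.single_apply]
    split_ifs <;> norm_num

lemma TG_finite (a : Fin 2 → ℕ) (k : Fin 2) : (TG a k).Finite := by
  refine ((PosG_finite.subset fun _ h => h.1 : (PhiKG k).Finite).image
    fun α => ip (lamG a + rhoG) α / ip (wG k) α).subset ?_
  rintro _ ⟨α, hα, rfl⟩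
  exact ⟨α, hα, rfl⟩

lemma one_mem_TG {k : Fin 2} {a : Fin 2 → ℕ} (hk : a k = 0) : (1 : ℝ) ∈ TG a k := by
  have h0 : ip (wG 0) (sroot k) = (Pi.single k (1 : ℝ) : Fin 2 → ℝ) 0 := by
    rw [sroot_eq_comb, ip_wG_zero_comb]
  have h1 : ip (wG 1) (sroot k) = 3 * (Pi.single k (1 : ℝ) : Fin 2 → ℝ) 1 := by
    rw [sroot_eq_comb, ip_wG_one_comb]
  refine ⟨sroot k, ⟨sroot_mem_PosG k, ?_⟩, ?_⟩
  · fin_cases k <;> simp_all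
  · rw [ip_lamG_add_rhoG]
    fin_cases k <;> simp_all

lemma one_le_of_mem_TG {k : Fin 2} {a : Fin 2 → ℕ} {r : ℝ} (hr : r ∈ TG a k) : 1 ≤ r := by
  obtain ⟨α, ⟨hα, hne⟩, rfl⟩ := hr
  rw [one_le_div ((ip_wG_nonneg hα k).lt_of_ne' hne)]
  exact ip_wG_le_ip_lamG_add_rhoG a hα k

lemma le_MG {k : Fin 2} {a : Fin 2 → ℕ} {r : ℝ} (hr : r ∈ TG a k) : r ≤ MG a k :=
  le_csSup (TG_finite a k).bddAbove hr

lemma MG_mem_TG {k : Fin 2} {a : Fin 2 → ℕ} (hk : a k = 0) : MG a k ∈ TG a k :=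
  Set.Nonempty.csSup_mem ⟨1, one_mem_TG hk⟩ (TG_finite a k)

lemma ip_shift (a : Fin 2 → ℕ) (k : Fin 2) (t : ℝ) (α : V) :
    ip (lamG a + rhoG - t • wG k) α = ip (lamG a + rhoG) α - t * ip (wG k) α := by
  rw [ip_sub_left, ip_smul_left]

/-- A zero pairing with a positive root occurs exactly for `t ∈ T_{λ,k}`. -/
lemma exists_ip_shift_eq_zero_iff (a : Fin 2 → ℕ) (k : Fin 2) (t : ℝ) :
    (∃ α ∈ PosG, ip (lamG a + rhoG - t • wG k) α = 0) ↔ t ∈ TG a k := by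
  simp only [ip_shift]
  constructor
  · rintro ⟨α, hα, h⟩
    have hne : ip (wG k) α ≠ 0 := fun h0 => by
      rw [h0] at h
      linarith [ip_lamG_add_rhoG_pos a hα]
    exact ⟨α, ⟨hα, hne⟩, by rw [eq_div_iff hne]; linarith⟩
  · rintro ⟨α, ⟨hα, hne⟩, rfl⟩
    exact ⟨α, hα, by rw [div_mul_cancel₀ _ hne, sub_self]⟩

/-- The shifted weight is strictly dominant exactly for `t < 1`. -/
lemma forall_ip_shift_pos_iff {k : Fin 2} {a : Fin 2 → ℕ} (hk : a k = 0) (t : ℝ) :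
    (∀ α ∈ PosG, 0 < ip (lamG a + rhoG - t • wG k) α) ↔ t < 1 := by
  simp only [ip_shift]
  constructor
  · intro h
    obtain ⟨α, ⟨hα, hne⟩, h1⟩ := one_mem_TG hk
    have hpos := (ip_wG_nonneg hα k).lt_of_ne' hne
    rw [h1, lt_div_iff₀ hpos]
    linarith [h α hα]
  · intro ht α hα
    rcases (ip_wG_nonneg hα k).eq_or_lt with h0 | hpos
    · rw [← h0]
      linarith [ip_lamG_add_rhoG_pos a hα]
    · nlinarith [ip_wG_le_ip_lamG_add_rhoG a hα k]

/-- All roots of `Φ⁺_k` pair negatively with the shifted weight exactly for `t > M_{λ,k}`. -/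
lemma ncard_ip_shift_neg_iff {k : Fin 2} {a : Fin 2 → ℕ} (hk : a k = 0) (t : ℝ) :
    {α ∈ PosG | ip (lamG a + rhoG - t • wG k) α < 0}.ncard = (PhiKG k).ncard ↔
      MG a k < t := by
  have hfin : (PhiKG k).Finite := PosG_finite.subset fun _ h => h.1
  have hsub : {α ∈ PosG | ip (lamG a + rhoG - t • wG k) α < 0} ⊆ PhiKG k := by
    rintro α ⟨hα, h⟩
    refine ⟨hα, fun h0 => ?_⟩
    rw [ip_shift, h0] at h
    linarith [ip_lamG_add_rhoG_pos a hα]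
  constructor
  · intro h
    have heq := Set.eq_of_subset_of_ncard_le hsub h.ge hfin
    obtain ⟨α, hα, hM⟩ := MG_mem_TG hk
    have hneg := (heq.ge hα).2
    rw [ip_shift] at hneg
    rw [hM, div_lt_iff₀ ((ip_wG_nonneg hα.1 k).lt_of_ne' hα.2)]
    linarith
  · intro h
    congr 1
    refine hsub.antisymm fun α hα => ⟨hα.1, ?_⟩
    have hlt := (le_MG (a := a) ⟨α, hα, rfl⟩).trans_lt h
    rw [div_lt_iff₀ ((ip_wG_nonneg hα.1 k).lt_of_ne' hα.2)] at hlt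
    rw [ip_shift]
    linarith

/-- the Borel–Weil–Bott criterion for `T_{λ,k} ∩ ℤ = [1, M_{λ,k}]`
    on G2/P_{α_k}. -/
theorem stmt4 (k : Fin 2) (a : Fin 2 → ℕ) (hk : a k = 0) :
    ACMG a k ↔
      ∀ t : ℤ,
        (∀ α ∈ PosG, 0 < ip (lamG a + rhoG - (t : ℝ) • wG k) α) ∨
        ({α ∈ PosG | ip (lamG a + rhoG - (t : ℝ) • wG k) α < 0}.ncard
            = (PhiKG k).ncard ∧
          ∀ α ∈ PosG, ip (lamG a + rhoG - (t : ℝ) • wG k) α ≠ 0) ∨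
        (∃ α ∈ PosG, ip (lamG a + rhoG - (t : ℝ) • wG k) α = 0) := by
  have hne (t : ℤ) : (∀ α ∈ PosG, ip (lamG a + rhoG - (t : ℝ) • wG k) α ≠ 0) ↔
      (t : ℝ) ∉ TG a k := by
    rw [← exists_ip_shift_eq_zero_iff]
    push Not
    rfl
  simp only [forall_ip_shift_pos_iff hk, ncard_ip_shift_neg_iff hk,
    exists_ip_shift_eq_zero_iff, hne, ACMG, Set.ext_iff, Set.mem_ofPred_eq]
  refine forall_congr' fun t => ⟨fun h => ?_, fun h => ⟨fun ht => ?_, ?_⟩⟩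
  · by_cases ht : (t : ℝ) ∈ TG a k
    · exact Or.inr (Or.inr ht)
    · rcases lt_or_ge t 1 with h1 | h1
      · exact Or.inl (by exact_mod_cast h1)
      · exact Or.inr (Or.inl ⟨not_le.mp fun hM => ht (h.mpr ⟨h1, hM⟩), ht⟩)
  · exact ⟨by exact_mod_cast one_le_of_mem_TG ht, le_MG ht⟩
  · rintro ⟨h1, hM⟩
    rcases h with h | h | h
    · exact absurd (by exact_mod_cast h : t < 1) h1.not_gt
    · exact absurd h.1 hM.not_gt
    · exact h
end
end

section
/- Let λ = a_1 ϖ_1 + a_2 ϖ_2 with a_1, a_2 nonnegative integers and a_1 = 0. Then T_{λ,1} ∩ ℤ = {1, 2, …, M_{λ,1}} if and only if a_1 = a_2 = 0. (This is the combinatorial criterion, via the main theorem, for an initialized irreducible homogeneous vector bundle on G2/P_{α_1} with highest weight λ to be an ACM bundle.) -/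
noncomputable section

theorem ip_wG_zero (α : V) : ip (wG 0) α = α 0 - α 2 := by
  simp [ip, wG, eps, Fin.sum_univ_three]; ring

theorem ip_wG_zero_vec (x y z : ℝ) : ip (wG 0) ![x, y, z] = x - z :=
  ip_wG_zero _

/-- The positive roots of G2 that are not orthogonal to the first fundamental weight. -/
theorem mem_PhiKG_zero_iff (α : V) :
    α ∈ PhiKG 0 ↔ α = ![0, 1, -1] ∨ α = ![1, -1, 0] ∨ α = ![1, 0, -1] ∨
      α = ![1, 1, -2] ∨ α = ![2, -1, -1] := by
  constructor
  · rintro ⟨⟨hroot, c, hc, hα⟩, hne⟩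
    have hc0 := hc 0
    have hc1 := hc 1
    have h0 : α 0 = c 1 := by simp [hα, Fin.sum_univ_two, sroot, eps]
    have h1 : α 1 = c 0 - 2 * c 1 := by
      simp [hα, Fin.sum_univ_two, sroot, eps]; ring
    have h2 : α 2 = c 1 - c 0 := by
      simp [hα, Fin.sum_univ_two, sroot, eps]; ring
    have hpos : 0 < α 0 - α 2 := by
      rw [ip_wG_zero] at hne
      exact lt_of_le_of_ne (by linarith) hne.symm
    have hx : 0 ≤ α 0 := by linarith
    have hy : 0 ≤ α 1 + 2 * α 0 := by linarith
    clear hα h0 h1 h2 hne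
    simp only [funext_iff, Fin.forall_fin_succ, IsEmpty.forall_iff]
    rcases hroot with ⟨i, j, hij, rfl | rfl⟩ | ⟨i, j, k, hij, hik, hjk, rfl | rfl⟩
    · fin_cases i <;> fin_cases j <;> simp [eps] at *
    · fin_cases i <;> fin_cases j <;> simp [eps] at * <;> norm_num at *
    · fin_cases i <;> fin_cases j <;> fin_cases k <;> simp [eps] at * <;> norm_num at *
    · fin_cases i <;> fin_cases j <;> fin_cases k <;> simp [eps] at * <;> norm_num at *
  · have hcomb (x y z p q : ℝ) (hp : 0 ≤ p) (hq : 0 ≤ q) (hx : x = q) (hy : y = p - 2 * q)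
        (hz : z = q - p) :
        ∃ c : Fin 2 → ℝ, (∀ i, 0 ≤ c i) ∧ (![x, y, z] : V) = ∑ i, c i • sroot i := by
      refine ⟨![p, q], by simp [Fin.forall_fin_two, hp, hq], ?_⟩
      ext i
      fin_cases i <;> simp [Fin.sum_univ_two, sroot, eps, hx, hy, hz] <;> ring
    rintro (rfl | rfl | rfl | rfl | rfl)
    · refine ⟨⟨Or.inl ⟨1, 2, by decide, Or.inl ?_⟩, hcomb _ _ _ 1 0 ?_ ?_ ?_ ?_ ?_⟩, ?_⟩
      · ext i; fin_cases i <;> simp [eps]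
      all_goals norm_num [ip_wG_zero_vec]
    · refine ⟨⟨Or.inl ⟨0, 1, by decide, Or.inl ?_⟩, hcomb _ _ _ 1 1 ?_ ?_ ?_ ?_ ?_⟩, ?_⟩
      · ext i; fin_cases i <;> simp [eps]
      all_goals norm_num [ip_wG_zero_vec]
    · refine ⟨⟨Or.inl ⟨0, 2, by decide, Or.inl ?_⟩, hcomb _ _ _ 2 1 ?_ ?_ ?_ ?_ ?_⟩, ?_⟩
      · ext i; fin_cases i <;> simp [eps]
      all_goals norm_num [ip_wG_zero_vec]
    · refine ⟨⟨Or.inr ⟨2, 0, 1, by decide, by decide, by decide, Or.inr ?_⟩,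
        hcomb _ _ _ 3 1 ?_ ?_ ?_ ?_ ?_⟩, ?_⟩
      · ext i; fin_cases i <;> simp [eps]
      all_goals norm_num [ip_wG_zero_vec]
    · refine ⟨⟨Or.inr ⟨0, 1, 2, by decide, by decide, by decide, Or.inl ?_⟩,
        hcomb _ _ _ 3 2 ?_ ?_ ?_ ?_ ?_⟩, ?_⟩
      · ext i; fin_cases i <;> simp [eps]
      all_goals norm_num [ip_wG_zero_vec]

theorem mem_TG_zero_iff (a : Fin 2 → ℕ) (h : a 0 = 0) (r : ℝ) :
    r ∈ TG a 0 ↔ r = 1 ∨ r = 1 + 3 * ((a 1 : ℝ) + 1) ∨ r = 1 + 3 / 2 * ((a 1 : ℝ) + 1) ∨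
      r = 1 + ((a 1 : ℝ) + 1) ∨ r = 1 + 2 * ((a 1 : ℝ) + 1) := by
  have hl (x y z : ℝ) : ip (lamG a + rhoG) ![x, y, z] =
      x - z + ((a 1 : ℝ) + 1) * (2 * x - y - z) := by
    simp [ip, lamG, rhoG, wG, eps, Fin.sum_univ_three, Fin.sum_univ_two, h]; ring
  simp only [TG, mem_PhiKG_zero_iff, Set.mem_ofPred_eq, or_and_right, exists_or, exists_eq_left,
    ip_wG_zero_vec, hl]
  ring_nf

theorem MG_zero_eq (a : Fin 2 → ℕ) (h : a 0 = 0) : MG a 0 = 1 + 3 * ((a 1 : ℝ) + 1) := by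
  have hg : IsGreatest (TG a 0) (1 + 3 * ((a 1 : ℝ) + 1)) := by
    refine ⟨(mem_TG_zero_iff a h _).2 (by simp), fun r hr => ?_⟩
    have ha : (0 : ℝ) ≤ a 1 := Nat.cast_nonneg _
    rcases (mem_TG_zero_iff a h r).1 hr with rfl | rfl | rfl | rfl | rfl <;> linarith
  exact hg.csSup_eq

/-- the ACM criterion on G2/P_{α_1} (k = 1 is indexed here
    by 0). -/
theorem stmt18 (a : Fin 2 → ℕ) (h : a 0 = 0) :
    ACMG a 0 ↔ (a 0 = 0 ∧ a 1 = 0) := by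
  rw [ACMG, Set.ext_iff]
  simp only [Set.mem_ofPred_eq, mem_TG_zero_iff a h, MG_zero_eq a h]
  constructor
  · intro H
    refine ⟨h, ?_⟩
    by_contra hne
    have ha : (1 : ℝ) ≤ a 1 := by exact_mod_cast Nat.one_le_iff_ne_zero.2 hne
    have h2 := (H 2).2 ⟨by norm_num, by push_cast; linarith⟩
    push_cast at h2
    rcases h2 with h2 | h2 | h2 | h2 | h2 <;> linarith
  · rintro ⟨-, h1⟩ n
    rw [h1]
    constructor
    · rintro (hn | hn | hn | hn | hn)
      · have : n = 1 := by exact_mod_cast hn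
        subst this; norm_num
      · have : n = 4 := by exact_mod_cast (by linear_combination hn : (n : ℝ) = 4)
        subst this; norm_num
      · have : 2 * n = 5 := by
          exact_mod_cast (by linear_combination 2 * hn : 2 * (n : ℝ) = 5)
        omega
      · have : n = 2 := by exact_mod_cast (by linear_combination hn : (n : ℝ) = 2)
        subst this; norm_num
      · have : n = 3 := by exact_mod_cast (by linear_combination hn : (n : ℝ) = 3)
        subst this; norm_num
    · rintro ⟨hn, hn4⟩
      have : n ≤ 4 := by exact_mod_cast (by norm_num at hn4 ⊢; linarith : (n : ℝ) ≤ 4)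
      interval_cases n <;> norm_num
end
end
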